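/- Let X be a proper Busemann space, x₀ ∈ X, and (x_k) a sequence with d(x₀,x_k) → ∞ such that d(y,x_k) − d(x₀,x_k) → φ(y) for every y ∈ X. Let c : [0,∞) → X be the ray with c(0) = x₀ such that for each t > 0, φ(c(t)) = −t is the minimum of φ over the closed ball of radius t about x₀. For each k with x_k ≠ x₀ let γ_k : [0,1] → X be a geodesic from x₀ to x_k. Then for every t > 0, the points γ_k(t/d(x₀,x_k)) converge to c(t) as k → ∞. -/

import Mathlib

open Filter

def IsGeodesicSeg {X : Type*} [MetricSpace X] (γ : ℝ → X) (x y : X) : Prop :=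
  γ 0 = x ∧ γ 1 = y ∧
    ∀ s ∈ Set.Icc (0 : ℝ) 1, ∀ t ∈ Set.Icc (0 : ℝ) 1,
      dist (γ s) (γ t) = |s - t| * dist x y

def IsBusemannSpace (X : Type*) [MetricSpace X] : Prop :=
  (∀ x y : X, ∃ γ : ℝ → X, IsGeodesicSeg γ x y) ∧
    ∀ (γ₁ γ₂ : ℝ → X) (x y₁ y₂ : X), IsGeodesicSeg γ₁ x y₁ → IsGeodesicSeg γ₂ x y₂ →
      ∀ t ∈ Set.Icc (0 : ℝ) 1, dist (γ₁ t) (γ₂ t) ≤ t * dist y₁ y₂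

def IsRay {X : Type*} [MetricSpace X] (c : ℝ → X) : Prop :=
  ∀ s t : ℝ, 0 ≤ s → 0 ≤ t → dist (c s) (c t) = |s - t|

/-- `m` is a metric midpoint of `x` and `y`. -/
def IsMetricMidpoint {X : Type*} [MetricSpace X] (m x y : X) : Prop :=
  dist x m = dist x y / 2 ∧ dist m y = dist x y / 2

section Midpoints

variable {X : Type*} [MetricSpace X]

theorem IsMetricMidpoint.symm {m x y : X} (h : IsMetricMidpoint m x y) :
    IsMetricMidpoint m y x := by
  obtain ⟨h₁, h₂⟩ := h
  constructor
  · rw [dist_comm y m, h₂, dist_comm]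
  · rw [dist_comm m x, h₁, dist_comm]

theorem IsGeodesicSeg.isMetricMidpoint {γ : ℝ → X} {x y : X} (h : IsGeodesicSeg γ x y) :
    IsMetricMidpoint (γ (1 / 2)) x y := by
  obtain ⟨h₀, h₁, hd⟩ := h
  have ha := hd 0 (by norm_num) (1 / 2) (by norm_num)
  have hb := hd (1 / 2) (by norm_num) 1 (by norm_num)
  rw [h₀] at ha
  rw [h₁] at hb
  norm_num at ha hb
  constructor <;> norm_num <;> linarith

/-- Two geodesics meeting at a midpoint concatenate to a geodesic. -/
theorem IsGeodesicSeg.concat {α β : ℝ → X} {x m y : X} (hα : IsGeodesicSeg α x m)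
    (hβ : IsGeodesicSeg β m y) (hm : IsMetricMidpoint m x y) :
    IsGeodesicSeg (fun t => if t ≤ 1 / 2 then α (2 * t) else β (2 * t - 1)) x y := by
  obtain ⟨α₀, α₁, hα⟩ := hα
  obtain ⟨β₀, β₁, hβ⟩ := hβ
  obtain ⟨hxm, hmy⟩ := hm
  rw [hxm] at hα
  rw [hmy] at hβ
  have cross : ∀ s t : ℝ, 0 ≤ s → s ≤ 1 / 2 → 1 / 2 ≤ t → t ≤ 1 →
      dist (α (2 * s)) (β (2 * t - 1)) = (t - s) * dist x y := by
    intro s t hs0 hs ht ht1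
    have e₁ := hα 0 (by norm_num) (2 * s) ⟨by linarith, by linarith⟩
    have e₂ := hα (2 * s) ⟨by linarith, by linarith⟩ 1 (by norm_num)
    have e₃ := hβ 0 (by norm_num) (2 * t - 1) ⟨by linarith, by linarith⟩
    have e₄ := hβ (2 * t - 1) ⟨by linarith, by linarith⟩ 1 (by norm_num)
    rw [abs_of_nonpos (by linarith)] at e₁ e₂ e₃ e₄
    rw [α₀] at e₁
    rw [α₁] at e₂
    rw [β₀] at e₃
    rw [β₁] at e₄
    have t₁ := dist_triangle (α (2 * s)) m (β (2 * t - 1))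
    have t₂ := dist_triangle4 x (α (2 * s)) (β (2 * t - 1)) y
    apply le_antisymm <;> linarith
  refine ⟨by simp [α₀], by norm_num [β₁], ?_⟩
  rintro s ⟨hs0, hs1⟩ t ⟨ht0, ht1⟩
  dsimp only
  split_ifs with hs ht ht
  · rw [hα _ ⟨by linarith, by linarith⟩ _ ⟨by linarith, by linarith⟩,
      ← mul_sub, abs_mul, abs_two]
    ring
  · rw [cross s t hs0 hs (by linarith) ht1, abs_of_nonpos (by linarith)]
    ring
  · rw [dist_comm, cross t s ht0 ht (by linarith) hs1, abs_of_nonneg (by linarith)]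
  · rw [hβ _ ⟨by linarith, by linarith⟩ _ ⟨by linarith, by linarith⟩,
      show 2 * s - 1 - (2 * t - 1) = 2 * (s - t) by ring, abs_mul, abs_two]
    ring

namespace IsBusemannSpace

theorem exists_midpoint (hX : IsBusemannSpace X) (x y : X) : ∃ m, IsMetricMidpoint m x y := by
  obtain ⟨γ, hγ⟩ := hX.1 x y
  exact ⟨_, hγ.isMetricMidpoint⟩

theorem dist_midpoint_le (hX : IsBusemannSpace X) {p x y m n : X}
    (hm : IsMetricMidpoint m p x) (hn : IsMetricMidpoint n p y) :
    dist m n ≤ dist x y / 2 := by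
  obtain ⟨α₁, hα₁⟩ := hX.1 p m
  obtain ⟨β₁, hβ₁⟩ := hX.1 m x
  obtain ⟨α₂, hα₂⟩ := hX.1 p n
  obtain ⟨β₂, hβ₂⟩ := hX.1 n y
  have h := hX.2 _ _ p x y (hα₁.concat hβ₁ hm) (hα₂.concat hβ₂ hn) (1 / 2) (by norm_num)
  norm_num [hα₁.2.1, hα₂.2.1] at h
  linarith

theorem midpoint_unique (hX : IsBusemannSpace X) {x y m n : X}
    (hm : IsMetricMidpoint m x y) (hn : IsMetricMidpoint n x y) : m = n := by
  have h := hX.dist_midpoint_le hm hn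
  rw [dist_self, zero_div] at h
  exact dist_le_zero.1 h

theorem dist_midpoint_le_average (hX : IsBusemannSpace X) {p q m : X}
    (hm : IsMetricMidpoint m p q) (x : X) :
    dist m x ≤ (dist p x + dist q x) / 2 := by
  obtain ⟨u, hu⟩ := hX.exists_midpoint p x
  linarith [hX.dist_midpoint_le hm hu, hu.2, dist_triangle m u x]

/-- If the midpoint of two points of a ball lies outside the open ball, then so it does for the
ball of half the radius centred at the common midpoint of the two radii. -/
theorem exists_half_radius (hX : IsBusemannSpace X) {p q m b : X} {r : ℝ}
    (hm : IsMetricMidpoint m p q) (hp : dist b p ≤ r) (hq : dist b q ≤ r) (hr : r ≤ dist b m) :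
    ∃ b', dist b' p ≤ r / 2 ∧ dist b' q ≤ r / 2 ∧ r / 2 ≤ dist b' m := by
  have key : ∀ {p q n : X}, IsMetricMidpoint m p q → dist b p ≤ r → dist b q ≤ r →
      IsMetricMidpoint n p b → IsMetricMidpoint n b m ∧ dist n p ≤ r / 2 ∧ r / 2 ≤ dist n m := by
    intro p q n hm hp hq hn
    have h₁ := hX.dist_midpoint_le hn hm
    have h₂ := hX.dist_midpoint_le_average hm b
    have h₃ := dist_triangle b n m
    obtain ⟨h₄, h₅⟩ := hn
    rw [dist_comm p b] at h₄ h₅ h₂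
    rw [dist_comm m b, dist_comm q b] at h₂
    rw [dist_comm p n] at h₄
    rw [dist_comm n b] at h₅
    refine ⟨⟨?_, ?_⟩, ?_, ?_⟩ <;> linarith
  obtain ⟨n, hn⟩ := hX.exists_midpoint p b
  obtain ⟨n', hn'⟩ := hX.exists_midpoint q b
  obtain ⟨k₁, k₂, k₃⟩ := key hm hp hq hn
  obtain ⟨l₁, l₂, -⟩ := key hm.symm hq hp hn'
  obtain rfl := hX.midpoint_unique k₁ l₁
  exact ⟨n, k₂, l₂, k₃⟩

/-- Balls of a Busemann space are strictly convex. -/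
theorem eq_of_le_dist_midpoint (hX : IsBusemannSpace X) {p q m b : X} {r : ℝ}
    (hm : IsMetricMidpoint m p q) (hp : dist b p ≤ r) (hq : dist b q ≤ r) (hr : r ≤ dist b m) :
    p = q := by
  have h : ∀ n : ℕ, ∃ b', dist b' p ≤ r * (1 / 2) ^ n ∧ dist b' q ≤ r * (1 / 2) ^ n ∧
      r * (1 / 2) ^ n ≤ dist b' m := by
    intro n
    induction n with
    | zero => exact ⟨b, by simpa using ⟨hp, hq, hr⟩⟩
    | succ n ih =>
      obtain ⟨b', h₁, h₂, h₃⟩ := ih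
      rw [show r * (1 / 2 : ℝ) ^ (n + 1) = r * (1 / 2) ^ n / 2 by ring]
      exact hX.exists_half_radius hm h₁ h₂ h₃
  have hlim : Tendsto (fun n : ℕ => 2 * (r * (1 / 2 : ℝ) ^ n)) atTop (nhds (2 * (r * 0))) :=
    ((tendsto_pow_atTop_nhds_zero_of_lt_one (by norm_num) (by norm_num)).const_mul r).const_mul 2
  rw [mul_zero, mul_zero] at hlim
  refine dist_le_zero.1 (ge_of_tendsto' hlim fun n => ?_)
  obtain ⟨b', h₁, h₂, -⟩ := h n
  linarith [dist_triangle_left p q b']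

/-- A limit of normalized distance functions takes the value `-t` at most once on the closed ball
of radius `t` about the base point. -/
theorem eq_of_horofunction_le (hX : IsBusemannSpace X) {x₀ p q : X} {x : ℕ → X} {φ : X → ℝ}
    (hlim : ∀ y : X, Tendsto (fun k => dist y (x k) - dist x₀ (x k)) atTop (nhds (φ y)))
    {t : ℝ} (hp : dist x₀ p ≤ t) (hq : dist x₀ q ≤ t) (hφp : φ p ≤ -t) (hφq : φ q ≤ -t) :
    p = q := by
  obtain ⟨m, hm⟩ := hX.exists_midpoint p q
  refine hX.eq_of_le_dist_midpoint hm hp hq ?_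
  have h₁ : φ m ≤ (φ p + φ q) / 2 :=
    le_of_tendsto_of_tendsto' (hlim m) (((hlim p).add (hlim q)).div_const 2) fun k => by
      linarith [hX.dist_midpoint_le_average hm (x k)]
  have h₂ : -dist x₀ m ≤ φ m := ge_of_tendsto' (hlim m) fun k => by
    linarith [dist_triangle x₀ m (x k)]
  linarith

end IsBusemannSpace

end Midpoints

/-- If `(x_k)` generates the horofunction `φ`, `c` is the associated ray from `x₀`
(along which `φ` attains its minima `-t` on balls of radius `t`), and `γ_k` is a
geodesic from `x₀` to `x_k`, then `γ_k (t / dist x₀ x_k) → c t` for every `t > 0`. -/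
theorem geodesics_converge_to_ray {X : Type*} [MetricSpace X] [ProperSpace X]
    (hX : IsBusemannSpace X) (x₀ : X) (x : ℕ → X) (φ : X → ℝ)
    (hdiv : Tendsto (fun k => dist x₀ (x k)) atTop atTop)
    (hlim : ∀ y : X, Tendsto (fun k => dist y (x k) - dist x₀ (x k)) atTop (nhds (φ y)))
    (c : ℝ → X) (hc : IsRay c) (hc0 : c 0 = x₀)
    (hmin : ∀ t : ℝ, 0 < t → φ (c t) = -t ∧ ∀ y : X, dist x₀ y ≤ t → -t ≤ φ y)
    (γ : ℕ → ℝ → X) (hγ : ∀ k, x k ≠ x₀ → IsGeodesicSeg (γ k) x₀ (x k)) :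
    ∀ t : ℝ, 0 < t →
      Tendsto (fun k => γ k (t / dist x₀ (x k))) atTop (nhds (c t)) := by
  intro t ht
  have hpt : ∀ᶠ k in atTop, dist x₀ (γ k (t / dist x₀ (x k))) = t ∧
      dist (γ k (t / dist x₀ (x k))) (x k) = dist x₀ (x k) - t := by
    filter_upwards [hdiv.eventually_ge_atTop t] with k hk
    have hpos : 0 < dist x₀ (x k) := ht.trans_le hk
    obtain ⟨h₀, h₁, hd⟩ := hγ k (dist_pos.1 hpos).symm
    have hs₀ : 0 ≤ t / dist x₀ (x k) := by positivity
    have hs₁ : t / dist x₀ (x k) ≤ 1 := (div_le_one hpos).2 hk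
    have ha := hd 0 (by norm_num) _ ⟨hs₀, hs₁⟩
    have hb := hd _ ⟨hs₀, hs₁⟩ 1 (by norm_num)
    rw [abs_of_nonpos (by linarith)] at ha hb
    rw [h₀] at ha
    rw [h₁] at hb
    rw [ha, hb]
    constructor <;> field_simp <;> ring
  refine (isCompact_closedBall x₀ t).tendsto_nhds_of_unique_mapClusterPt ?_ ?_
  · filter_upwards [hpt] with k hk
    rw [Metric.mem_closedBall, dist_comm, hk.1]
  · intro p hp hcl
    rw [Metric.mem_closedBall, dist_comm] at hp
    have hct : dist x₀ (c t) ≤ t := by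
      rw [← hc0, hc 0 t le_rfl ht.le, zero_sub, abs_neg, abs_of_pos ht]
    refine hX.eq_of_horofunction_le hlim hp hct ?_ (hmin t ht).1.le
    refine le_of_forall_pos_le_add fun ε hε => ?_
    have hfreq := hcl.frequently (Metric.ball_mem_nhds p (half_pos hε))
    have hev := (hlim p).eventually (Metric.ball_mem_nhds (φ p) (half_pos hε))
    obtain ⟨k, hk₁, hk₂, hk₃⟩ := (hfreq.and_eventually (hpt.and hev)).exists
    rw [Real.dist_eq] at hk₃
    linarith [(abs_lt.1 hk₃).1, hk₂.2,
      dist_triangle_left p (x k) (γ k (t / dist x₀ (x k)))]
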